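/- arXiv:2409.12103 — 2 statements merged into one kernel-verified Lean document; each statement's English description precedes it below -/
import Mathlib

section
/- For θ ∈ ℝ and m ≥ 0, let E(θ) be the linear map from ℂ^(Fin 2 × (Fin m → Fin 2)) to ℂ^(Fin 2 × (Fin (m+1) → Fin 2)) defined on basis vectors by E(θ) e_{(b, x)} = e^{i b θ} e_{(b, x')} where x' appends a new photon coordinate equal to b (i.e. the spin qubit b emits a photon in state |b⟩ and acquires phase e^{iθ} when b = 1). Then for any α, β ∈ ℂ and any θ₁, …, θ_n ∈ ℝ, applying E(θ_n) ∘ ⋯ ∘ E(θ₁) to the spin state α e_{(0,·)} + β e_{(1,·)} (with no photons) yields α · e_{(0, 0…0)} + e^{i Σ_{i=1}^n θ_i} β · e_{(1, 1…1)}, a rotated GHZ state on the spin together with n photons. -/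
/-- The rotated emission operator `E(θ)` of the paper, acting on states of a spin qubit
together with `m` photonic qubits (vectors in `ℂ^(Fin 2 × (Fin m → Fin 2))`).
On basis vectors it acts as `E(θ) e_{(b,x)} = e^{i b θ} e_{(b, snoc x b)}`:
the spin `b` emits a photon in state `|b⟩` and acquires the phase `e^{iθ}` when `b = 1`. -/
noncomputable def emit (m : ℕ) (θ : ℝ) (f : Fin 2 × (Fin m → Fin 2) → ℂ) :
    Fin 2 × (Fin (m + 1) → Fin 2) → ℂ :=
  fun p =>
    if p.2 (Fin.last m) = p.1 then
      Complex.exp (Complex.I * ((p.1 : ℕ) : ℂ) * (θ : ℂ)) * f (p.1, Fin.init p.2)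
    else 0

/-- The composition `E(θ_n) ∘ ⋯ ∘ E(θ₁)` applied to a pure spin state with no photons. -/
noncomputable def emitChain : (n : ℕ) → (Fin n → ℝ) →
    (Fin 2 × (Fin 0 → Fin 2) → ℂ) → (Fin 2 × (Fin n → Fin 2) → ℂ)
  | 0, _, f => f
  | n + 1, θ, f => emit n (θ (Fin.last n)) (emitChain n (fun i => θ i.castSucc) f)

theorem Fin.eq_const_iff_init_eq_const_and_last {α : Type*} {n : ℕ} (x : Fin (n + 1) → α) (c : α) :
    x = (fun _ => c) ↔ Fin.init x = (fun _ => c) ∧ x (Fin.last n) = c := by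
  simp only [funext_iff, Fin.forall_fin_succ', Fin.init]

theorem emit_single (m : ℕ) (ϑ : ℝ) (s : Fin 2) (x : Fin m → Fin 2) :
    emit m ϑ (Pi.single (s, x) 1) =
      Complex.exp (Complex.I * ((s : ℕ) : ℂ) * (ϑ : ℂ)) •
        (Pi.single (s, Fin.snoc x s) 1 : Fin 2 × (Fin (m + 1) → Fin 2) → ℂ) := by
  funext ⟨t, y⟩
  induction y using Fin.snocCases with
  | snoc y u =>
    simp only [emit, Fin.snoc_last, Fin.init_snoc, Pi.smul_apply, Pi.single_apply, Prod.mk.injEq,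
      Fin.snoc_inj, smul_eq_mul, mul_ite, mul_one, mul_zero]
    split_ifs <;> grind

theorem emitChain_spin (n : ℕ) (θ : Fin n → ℝ) (a b : ℂ) :
    emitChain n θ (fun p => if p.1 = 0 then a else b) =
      fun p =>
        if p.1 = 0 ∧ p.2 = (fun _ => 0) then a
        else if p.1 = 1 ∧ p.2 = (fun _ => 1) then
          Complex.exp (Complex.I * ((∑ i, θ i : ℝ) : ℂ)) * b
        else 0 := by
  induction n with
  | zero =>
    funext ⟨s, x⟩
    fin_cases s <;> simp [emitChain, eq_iff_true_of_subsingleton]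
  | succ n ih =>
    funext ⟨s, x⟩
    simp only [emitChain, ih, emit, Fin.eq_const_iff_init_eq_const_and_last x, Fin.sum_univ_castSucc]
    fin_cases s
    · by_cases h : x (Fin.last n) = 0 <;> simp [h]
    · by_cases h : x (Fin.last n) = 1
      · simp [h, mul_add, Complex.exp_add, mul_left_comm, mul_assoc]
      · simp [h]

/-- `E(θ)` acts on basis vectors as claimed, and applying `E(θ_n) ∘ ⋯ ∘ E(θ₁)` to the
spin state `α e_{(0,·)} + β e_{(1,·)}` (no photons) produces the rotated GHZ state
`α e_{(0,0…0)} + e^{i Σᵢ θᵢ} β e_{(1,1…1)}` on the spin together with `n` photons. -/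
theorem emission_chain_produces_rotated_GHZ (n : ℕ) (θ : Fin n → ℝ) (a b : ℂ) :
    (∀ (m : ℕ) (ϑ : ℝ) (s : Fin 2) (x : Fin m → Fin 2),
        emit m ϑ (Pi.single (s, x) 1) =
          Complex.exp (Complex.I * ((s : ℕ) : ℂ) * (ϑ : ℂ)) •
            (Pi.single (s, Fin.snoc x s) 1 : Fin 2 × (Fin (m + 1) → Fin 2) → ℂ))
    ∧ emitChain n θ (fun p => if p.1 = 0 then a else b) =
        fun p =>
          if p.1 = 0 ∧ p.2 = (fun _ => 0) then a
          else if p.1 = 1 ∧ p.2 = (fun _ => 1) then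
            Complex.exp (Complex.I * ((∑ i, θ i : ℝ) : ℂ)) * b
          else 0 :=
  ⟨emit_single, emitChain_spin n θ a b⟩
end

section
/- Let n ≥ 1, α, β ∈ ℂ, φ ∈ ℝ, and let ψ = α |0⟩^(⊗(n+1)) + e^{iφ} β |1⟩^(⊗(n+1)) be the rotated GHZ-type state in ℂ^(Fin (n+1) → Fin 2). For bits b₁, …, b_n ∈ {0,1}, let |b⟩_± = (|0⟩ + (-1)^b |1⟩)/√2. Then the partial inner product of ψ with ⊗_{i=1}^n |b_i⟩_± on the first n qubits equals 2^{-n/2} ( α |0⟩ + (-1)^(b₁ ⊕ ⋯ ⊕ b_n) e^{iφ} β |1⟩ ) on the remaining qubit. -/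
theorem Fin.snoc_eq_const_iff {n : ℕ} {α : Type*} (x : Fin n → α) (y c : α) :
    (Fin.snoc x y : Fin (n + 1) → α) = (fun _ => c) ↔ x = (fun _ => c) ∧ y = c := by
  simp [funext_iff, Fin.forall_fin_succ']


/-- GHZ collapse (correctness proof of Protocol 3): taking the partial inner product of the
rotated GHZ-type state `ψ = α|0⟩^⊗(n+1) + e^{iφ}β|1⟩^⊗(n+1)` with `⊗ᵢ |bᵢ⟩±` on the first
`n` qubits (where `|b⟩± = (|0⟩ + (-1)^b|1⟩)/√2`) leaves the last qubit in the state
`2^{-n/2} (α|0⟩ + (-1)^{b₁⊕⋯⊕b_n} e^{iφ} β |1⟩)`. -/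
theorem ghz_collapse
    (n : ℕ) (hn : 1 ≤ n) (a b : ℂ) (φ : ℝ) (bits : Fin n → Fin 2) :
    (fun y : Fin 2 =>
        ∑ x : Fin n → Fin 2,
          (∏ i, ((-1 : ℂ) ^ ((bits i : ℕ) * (x i : ℕ)) / (Real.sqrt 2 : ℂ))) *
            (a * (if Fin.snoc x y = (fun _ => (0 : Fin 2)) then 1 else 0) +
              Complex.exp (Complex.I * (φ : ℂ)) * b *
                (if Fin.snoc x y = (fun _ => (1 : Fin 2)) then 1 else 0)))
      = fun y : Fin 2 =>
          (1 / (Real.sqrt 2 : ℂ)) ^ n *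
            (if y = 0 then a
             else ((-1 : ℂ) ^ (∑ i, (bits i : ℕ))) * Complex.exp (Complex.I * (φ : ℂ)) * b) := by
  funext y
  simp only [Fin.snoc_eq_const_iff, mul_add, Finset.sum_add_distrib]
  fin_cases y
  · simp [Finset.prod_const]
  · simp [Finset.prod_div_distrib, Finset.prod_pow_eq_pow_sum]
    ring
end
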